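/- Let p be a prime, H a finite abelian p-group, and G an order controllable group shift over H. Then there exists a noncatastrophic isomorphic encoder for G: there exist m ∈ ℕ, positive integers h₁,…,h_m, and a topological group isomorphism Φ : (∏_{j=1}^m ℤ/p^{h_j}ℤ)^ℤ → G such that σ ∘ Φ = Φ ∘ σ and Φ maps the subgroup of finitely supported sequences onto G_f. In particular, G is algebraically and topologically conjugate to a full group shift over a finite abelian p-group. -/

import Mathlib

open Function Topology

/-- The backward shift by `n`: `(shiftPow n x) i = x (i + n)`. -/
def shiftPow {H : Type*} (n : ℤ) (x : ℤ → H) : ℤ → H := fun i => x (i + n)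

/-- The backward shift operator `σ`: `(shift x) i = x (i + 1)`. -/
abbrev shift {H : Type*} (x : ℤ → H) : ℤ → H := shiftPow 1 x

/-- A group shift over `H`: a closed, shift-invariant subgroup of the full shift `H^ℤ`. -/
def IsGroupShift {H : Type*} [AddCommGroup H] [TopologicalSpace H]
    (G : AddSubgroup (ℤ → H)) : Prop :=
  IsClosed (G : Set (ℤ → H)) ∧ shift '' (G : Set (ℤ → H)) = (G : Set (ℤ → H))

/-- `G_f`: the set of finitely supported elements of `G`. -/
def finSupp {H : Type*} [AddCommGroup H] (G : AddSubgroup (ℤ → H)) : Set (ℤ → H) :=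
  {x | x ∈ G ∧ (Function.support x).Finite}

/-- `G` is order controllable. -/
def IsOrderControllable {H : Type*} [AddCommGroup H] (G : AddSubgroup (ℤ → H)) : Prop :=
  ∃ n₀ : ℕ, 0 < n₀ ∧ ∀ g ∈ G, ∃ g₁ ∈ G,
    (∀ i : ℤ, i ≤ 0 → g₁ i = g i) ∧ (∀ i : ℤ, (n₀ : ℤ) < i → g₁ i = 0) ∧
    addOrderOf (fun j : Fin n₀ => g₁ ((j : ℤ) + 1)) ∣
      addOrderOf (fun j : Fin n₀ => g ((j : ℤ) + 1))

/-- A noncatastrophic isomorphic encoder for `G` with symbol group `K`: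
a topological group isomorphism `Φ : K^ℤ → G` commuting with the shift and
mapping the finitely supported sequences onto `G_f`. -/
def IsNoncatEncoder {H : Type*} [AddCommGroup H] [TopologicalSpace H]
    (G : AddSubgroup (ℤ → H)) (K : Type*) [AddCommGroup K] [TopologicalSpace K] : Prop :=
  ∃ Φ : (ℤ → K) ≃+ G,
    Continuous Φ ∧ Continuous Φ.symm ∧
    (∀ u : ℤ → K, ((Φ (shift u) : ℤ → H)) = shift ((Φ u : ℤ → H))) ∧
    ((fun u : ℤ → K => ((Φ u : ℤ → H))) '' {u | (Function.support u).Finite} = finSupp G)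

/-- Laurent polynomials over a field form a principal ideal ring. -/
theorem laurentPolynomial_isPrincipalIdealRing (K : Type*) [Field K] :
    IsPrincipalIdealRing (LaurentPolynomial K) := by
  refine ⟨fun I => ?_⟩
  obtain ⟨f, hf⟩ := (IsPrincipalIdealRing.principal (I.under (Polynomial K))).principal
  refine ⟨algebraMap _ _ f, ?_⟩
  rw [← IsLocalization.map_under (Submonoid.powers (Polynomial.X : Polynomial K))
    (LaurentPolynomial K) I, hf]
  simp [Ideal.submodule_span_eq, Ideal.map_span]

/-- A pure submodule of a finitely generated module over a PID has a complement. -/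
theorem exists_isCompl_of_pure {R E : Type*} [CommRing R] [IsDomain R] [IsPrincipalIdealRing R]
    [AddCommGroup E] [Module R E] [Module.Finite R E] (N : Submodule R E)
    (hpure : ∀ (q : R) (x : E), q ≠ 0 → q • x ∈ N → x ∈ N) :
    ∃ C : Submodule R E, IsCompl N C := by
  have : Module.IsTorsionFree R (E ⧸ N) := by
    refine .of_smul_eq_zero fun q x hx => ?_
    obtain ⟨x, rfl⟩ := N.mkQ_surjective x
    by_cases hq : q = 0
    · exact Or.inl hq
    · right
      rw [← map_smul, Submodule.mkQ_apply, Submodule.Quotient.mk_eq_zero] at hx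
      rw [Submodule.mkQ_apply, Submodule.Quotient.mk_eq_zero]
      exact hpure q x hq hx
  obtain ⟨s, hs⟩ := Module.projective_lifting_property N.mkQ LinearMap.id N.mkQ_surjective
  have hs' : ∀ y, N.mkQ (s y) = y := fun y => LinearMap.congr_fun hs y
  refine ⟨LinearMap.range s, ⟨?_, ?_⟩⟩
  · rw [Submodule.disjoint_def]
    rintro _ hx ⟨y, rfl⟩
    have : N.mkQ (s y) = 0 := by rwa [Submodule.mkQ_apply, Submodule.Quotient.mk_eq_zero]
    rw [hs'] at this
    simp [this]
  · rw [codisjoint_iff, eq_top_iff]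
    intro x _
    refine Submodule.mem_sup.2 ⟨x - s (N.mkQ x), ?_, s (N.mkQ x), ⟨_, rfl⟩, by simp⟩
    rw [← Submodule.Quotient.mk_eq_zero, ← Submodule.mkQ_apply, map_sub, hs', sub_self]

/-- A descending chain of pure submodules of a finitely generated module over a PID, ending in
`⊥`, has an adapted linearly independent family: each member of the chain is spanned by the
vectors of sufficiently high level. -/
theorem exists_adapted_linearIndependent {R E : Type*} [CommRing R] [IsDomain R]
    [IsPrincipalIdealRing R] [AddCommGroup E] [Module R E] [Module.Finite R E]
    (N : ℕ → Submodule R E) (hanti : Antitone N)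
    (hpure : ∀ (h : ℕ) (q : R) (x : E), q ≠ 0 → q • x ∈ N h → x ∈ N h)
    (d i : ℕ) (hd : N (i + d) = ⊥) :
    ∃ (J : Type) (_ : Fintype J) (v : J → E) (k : J → ℕ), LinearIndependent R v ∧
      (∀ j, i ≤ k j) ∧ ∀ h, i ≤ h → N h = Submodule.span R (v '' {j | h ≤ k j}) := by
  induction d generalizing i with
  | zero =>
    refine ⟨Empty, inferInstance, Empty.elim, Empty.elim, linearIndependent_empty_type,
      fun j => j.elim, fun h hi => ?_⟩
    have : N h ≤ ⊥ := hd ▸ hanti hi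
    simp [le_bot_iff.1 this, Set.image_eq_empty.2 (Set.eq_empty_of_isEmpty _)]
  | succ d ih =>
    obtain ⟨J, _, v, k, hv, hk, hs⟩ := ih (i + 1) (by rw [← hd]; congr 1; omega)
    obtain ⟨C', hC'⟩ := exists_isCompl_of_pure (N (i + 1)) (hpure (i + 1))
    have : Module.IsTorsionFree R E := by
      refine .of_smul_eq_zero fun q x hx => ?_
      by_cases hq : q = 0
      · exact Or.inl hq
      · right
        have := hpure (i + (d + 1)) q x hq (by simp [hx])
        simpa [hd] using this
    have hle : N (i + 1) ≤ N i := hanti (by omega)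
    obtain ⟨n, b⟩ := Module.basisOfFiniteTypeTorsionFree' (R := R) (M := ↥(C' ⊓ N i))
    have hspan : Submodule.span R (Set.range fun j => (b j : E)) = C' ⊓ N i := by
      have : (Set.range fun j => (b j : E)) = (C' ⊓ N i).subtype '' Set.range b := by
        rw [← Set.range_comp]; rfl
      rw [this, ← Submodule.map_span, b.span_eq]
      simp
    have hv1 : Submodule.span R (Set.range v) = N (i + 1) := by
      rw [hs (i + 1) le_rfl, ← Set.image_univ]
      congr 2
      exact (Set.eq_univ_of_forall hk).symm
    refine ⟨J ⊕ Fin n, inferInstance, Sum.elim v (fun j => (b j : E)),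
      Sum.elim k (fun _ => i), ?_, ?_, ?_⟩
    · refine hv.sum_type (b.linearIndependent.map' _ (Submodule.ker_subtype _)) ?_
      change Disjoint _ (Submodule.span R (Set.range fun j => (b j : E)))
      rw [hv1, hspan]
      exact hC'.disjoint.mono_right inf_le_left
    · rintro (j | j)
      · exact (Nat.le_succ i).trans (hk j)
      · exact le_rfl
    · intro h hi
      rcases hi.eq_or_lt with rfl | hi
      · have : {j | i ≤ Sum.elim k (fun _ : Fin n => i) j} = Set.univ := by
          refine Set.eq_univ_of_forall ?_
          rintro (j | j)
          · exact (Nat.le_succ i).trans (hk j)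
          · exact le_refl i
        rw [this, Set.image_univ, Set.Sum.elim_range, Submodule.span_union, hv1, hspan,
          ← sup_inf_assoc_of_le _ hle, hC'.sup_eq_top, top_inf_eq]
      · rw [hs h hi]
        congr 1
        ext x
        constructor
        · rintro ⟨j, hj, rfl⟩
          exact ⟨Sum.inl j, hj, rfl⟩
        · rintro ⟨j | j, hj, rfl⟩
          · exact ⟨j, hj, rfl⟩
          · exact absurd hj (not_le.2 hi)

section LaurentAction

variable {K A : Type*} [Field K] [AddCommGroup A] [Module K A]

/-- The action of the integers on sequences by right translation. -/
def translationRep (K A : Type*) [Field K] [AddCommGroup A] [Module K A] :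
    Multiplicative ℤ →* Module.End K (ℤ → A) where
  toFun m := LinearMap.funLeft K A fun n => n - m.toAdd
  map_one' := by ext x n; simp [LinearMap.funLeft]
  map_mul' m k := by ext x n; simp [LinearMap.funLeft, sub_sub]

/-- Laurent polynomials act on sequences by convolution. -/
noncomputable def laurentAct (K A : Type*) [Field K] [AddCommGroup A] [Module K A] :
    LaurentPolynomial K →ₐ[K] Module.End K (ℤ → A) :=
  AddMonoidAlgebra.lift K _ ℤ (translationRep K A)

theorem laurentAct_apply (q : LaurentPolynomial K) (x : ℤ → A) (n : ℤ) :
    laurentAct K A q x n = q.coeff.sum fun i c => c • x (n - i) := by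
  rw [laurentAct, AddMonoidAlgebra.lift_apply, Finsupp.sum, LinearMap.sum_apply,
    Finset.sum_apply]
  rfl

theorem laurentAct_C_mul_T (a : K) (m : ℤ) (x : ℤ → A) :
    laurentAct K A (LaurentPolynomial.C a * LaurentPolynomial.T m) x = a • shiftPow (-m) x := by
  ext n
  rw [laurentAct_apply, ← LaurentPolynomial.single_eq_C_mul_T, AddMonoidAlgebra.coeff_single,
    Finsupp.sum_single_index (by simp)]
  simp [shiftPow, sub_eq_add_neg]

theorem laurentAct_T (m : ℤ) (x : ℤ → A) :
    laurentAct K A (LaurentPolynomial.T m) x = shiftPow (-m) x := by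
  simpa using laurentAct_C_mul_T (1 : K) m x

theorem laurentAct_mul_apply (q r : LaurentPolynomial K) (x : ℤ → A) :
    laurentAct K A (q * r) x = laurentAct K A q (laurentAct K A r x) := by
  rw [map_mul, Module.End.mul_apply]

theorem laurentAct_coeff (q r : LaurentPolynomial K) :
    (laurentAct K K q fun n => r.coeff n) = fun n => (q * r).coeff n := by
  induction q using LaurentPolynomial.induction_on' with
  | add p q hp hq =>
    rw [map_add, LinearMap.add_apply, hp, hq, add_mul]
    rfl
  | C_mul_T m a =>
    rw [laurentAct_C_mul_T, ← LaurentPolynomial.single_eq_C_mul_T]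
    ext n
    rw [AddMonoidAlgebra.coeff_single_mul_eq_mul_coeff (n - m) fun k _ => by lia]
    simp [shiftPow, sub_eq_add_neg]

theorem laurentAct_mem (V : Submodule K (ℤ → A)) (hV : ∀ x ∈ V, ∀ n : ℤ, shiftPow n x ∈ V)
    (q : LaurentPolynomial K) {x : ℤ → A} (hx : x ∈ V) : laurentAct K A q x ∈ V := by
  induction q using LaurentPolynomial.induction_on' with
  | add p q hp hq =>
    rw [map_add, LinearMap.add_apply]
    exact V.add_mem hp hq
  | C_mul_T m a =>
    rw [laurentAct_C_mul_T]
    exact V.smul_mem _ (hV x hx _)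

theorem laurentAct_toLaurent_eq_zero (f : Polynomial K) {x : ℤ → A} {c : ℤ}
    (hx : ∀ n < c, x n = 0) {n : ℤ} (hn : n < c) :
    laurentAct K A (Polynomial.toLaurent f) x n = 0 := by
  rw [laurentAct_apply, Finsupp.sum]
  refine Finset.sum_eq_zero fun i hi => ?_
  rw [LaurentPolynomial.support_coeff_toLaurent] at hi
  obtain ⟨k, -, rfl⟩ := Finset.mem_map.1 hi
  rw [hx, smul_zero]
  change n - (k : ℤ) < c
  omega

/-- Closed shift-invariant spaces of sequences are pure with respect to sequences which vanish
far to the left. -/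
theorem mem_of_laurentAct_mem (V : Submodule K (ℤ → A))
    (hV : ∀ x ∈ V, ∀ n : ℤ, shiftPow n x ∈ V)
    (hclosed : ∀ x, (∀ n : ℕ, ∃ y ∈ V, ∀ m : ℤ, |m| ≤ n → y m = x m) → x ∈ V)
    {q : LaurentPolynomial K} (hq : q ≠ 0) {x : ℤ → A} {c : ℤ} (hx : ∀ n < c, x n = 0)
    (hqx : laurentAct K A q x ∈ V) : x ∈ V := by
  obtain ⟨n, f, hf⟩ := LaurentPolynomial.exists_T_pow q
  have hf0 : f ≠ 0 := by
    rintro rfl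
    rw [map_zero, eq_comm] at hf
    exact hq (((LaurentPolynomial.isUnit_T (n : ℤ)).mul_left_eq_zero).1 hf)
  obtain ⟨g, hg, hg0⟩ := Polynomial.exists_eq_pow_rootMultiplicity_mul_and_not_dvd f hf0 0
  set k := Polynomial.rootMultiplicity 0 f
  rw [Polynomial.C_0, sub_zero] at hg hg0
  rw [Polynomial.X_dvd_iff] at hg0
  obtain ⟨h, hh⟩ : Polynomial.X ∣ 1 - Polynomial.C (g.coeff 0)⁻¹ * g := by
    rw [Polynomial.X_dvd_iff]
    simp [hg0]
  have hgeom : ∀ m : ℕ, laurentAct K A (Polynomial.toLaurent (1 - (Polynomial.X * h) ^ m)) x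
      ∈ V := by
    intro m
    obtain ⟨s, hs⟩ : q ∣ Polynomial.toLaurent (1 - (Polynomial.X * h) ^ m) := by
      have h1 : g ∣ 1 - (Polynomial.X * h) ^ m := by
        refine dvd_trans ?_ (one_sub_dvd_one_sub_pow _ m)
        rw [← hh, sub_sub_cancel]
        exact dvd_mul_left _ _
      refine dvd_trans ?_ (map_dvd Polynomial.toLaurent h1)
      refine ⟨LaurentPolynomial.T n * LaurentPolynomial.T (-k), ?_⟩
      rw [← mul_assoc, ← hf, hg, map_mul, Polynomial.toLaurent_X_pow, mul_right_comm,
        ← LaurentPolynomial.T_add]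
      simp
    rw [hs, mul_comm, laurentAct_mul_apply]
    exact laurentAct_mem V hV s hqx
  refine hclosed x fun N => ⟨_, hgeom (N + 1 + c.natAbs), fun m hm => ?_⟩
  rw [map_sub, map_sub, LinearMap.sub_apply, Pi.sub_apply, map_one, map_one, sub_eq_self.2]
  · rfl
  · rw [mul_pow, map_mul, Polynomial.toLaurent_X_pow, laurentAct_mul_apply, laurentAct_T]
    refine laurentAct_toLaurent_eq_zero _ hx ?_
    have := abs_le.1 hm
    omega

theorem laurentAct_apply_of_support_subset (q : LaurentPolynomial K) (x : ℤ → A) (n : ℤ)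
    {S : Finset ℤ} (hS : q.coeff.support ⊆ S) :
    laurentAct K A q x n = ∑ i ∈ S, q.coeff i • x (n - i) := by
  rw [laurentAct_apply, Finsupp.sum_of_support_subset _ hS _ (by simp)]

theorem laurentAct_pi_apply {ι : Type*} (q : LaurentPolynomial K) (x : ℤ → ι → K) (n : ℤ)
    (i : ι) : laurentAct K (ι → K) q x n i = laurentAct K K q (fun m => x m i) n := by
  simp only [laurentAct_apply, Finsupp.sum, Finset.sum_apply, Pi.smul_apply]

/-- The finitely supported sequence of vectors whose coordinate generating functions are given
Laurent polynomials. -/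
def laurentSeq {ι : Type*} (r : ι → LaurentPolynomial K) : ℤ → ι → K :=
  fun n i => (r i).coeff n

theorem laurentSeq_smul {ι : Type*} (q : LaurentPolynomial K) (r : ι → LaurentPolynomial K) :
    laurentSeq (q • r) = laurentAct K (ι → K) q (laurentSeq r) := by
  ext n i
  rw [laurentAct_pi_apply]
  exact (congrFun (laurentAct_coeff q (r i)) n).symm

/-- The finitely supported elements of a shift-invariant space of sequences, as a submodule over
the Laurent polynomials. -/
def finSuppSubmodule {ι : Type*} (V : Submodule K (ℤ → ι → K))
    (hV : ∀ x ∈ V, ∀ n : ℤ, shiftPow n x ∈ V) :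
    Submodule (LaurentPolynomial K) (ι → LaurentPolynomial K) where
  carrier := {r | laurentSeq r ∈ V}
  add_mem' hr hs := V.add_mem hr hs
  zero_mem' := V.zero_mem
  smul_mem' q r hr := by
    change laurentSeq (q • r) ∈ V
    rw [laurentSeq_smul]
    exact laurentAct_mem V hV q hr

theorem exists_laurentSeq_eq {ι : Type*} {x : ℤ → ι → K} (hx : (support x).Finite) :
    ∃ r, laurentSeq r = x := by
  refine ⟨fun i => .ofCoeff (Finsupp.ofSupportFinite (fun n => x n i)
    (hx.subset fun n hn h => hn (by simp [h]))), ?_⟩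
  rfl

theorem exists_adapted_generators {ι : Type*} [Fintype ι] (V : ℕ → Submodule K (ℤ → ι → K))
    (hV0 : V 0 = ⊤) (hanti : Antitone V) {N : ℕ} (hN : V N = ⊥)
    (hshift : ∀ h, ∀ x ∈ V h, ∀ n : ℤ, shiftPow n x ∈ V h)
    (hclosed : ∀ h x, (∀ n : ℕ, ∃ y ∈ V h, ∀ m : ℤ, |m| ≤ n → y m = x m) → x ∈ V h)
    (hdense : ∀ h, 0 < h → ∀ x ∈ V h, ∀ n : ℕ, ∃ y ∈ V h, (support y).Finite ∧
      ∀ m : ℤ, |m| ≤ n → y m = x m) :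
    ∃ (J : Type) (_ : Fintype J) (e : J → ℤ → ι → K) (k : J → ℕ) (S : Finset ℤ),
      (∀ j, e j ∈ V (k j)) ∧ (∀ j, ∀ m ∉ S, e j m = 0) ∧
      (∀ h, ∀ x ∈ V h, ∃ a : J → ℤ → K, (∀ j, k j < h → a j = 0) ∧
        ∀ n, ∑ j, ∑ m ∈ S, a j (n - m) • e j m = x n) ∧
      ∀ a : J → ℤ → K, (∀ n, ∑ j, ∑ m ∈ S, a j (n - m) • e j m = 0) → a = 0 := by
  classical
  have := laurentPolynomial_isPrincipalIdealRing K
  set M := fun h => finSuppSubmodule (V h) (hshift h) with hM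
  have hpure : ∀ (h : ℕ) (q : LaurentPolynomial K) (r : ι → LaurentPolynomial K), q ≠ 0 →
      q • r ∈ M h → r ∈ M h := by
    intro h q r hq hqr
    obtain ⟨c, hc⟩ := (Finset.univ.biUnion fun i => (r i).coeff.support).bddBelow
    refine mem_of_laurentAct_mem (V h) (hshift h) (hclosed h) hq (c := c) ?_
      (by rw [← laurentSeq_smul]; exact hqr)
    intro n hn
    ext i
    by_contra hne
    exact absurd (hc (by simpa using ⟨i, hne⟩)) (not_le.2 hn)
  obtain ⟨J, _, v, k, hv, -, hspan⟩ := exists_adapted_linearIndependent M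
    (fun i j hij r hr => hanti hij hr) hpure N 0 (by
      rw [zero_add, eq_bot_iff]
      intro r hr
      have : laurentSeq r ∈ V N := hr
      rw [hN, Submodule.mem_bot] at this
      rw [Submodule.mem_bot]
      ext i n
      exact congrFun (congrFun this n) i)
  have hM0 : M 0 = ⊤ := by
    rw [eq_top_iff]
    intro r _
    change laurentSeq r ∈ V 0
    rw [hV0]
    trivial
  have htop : ⊤ ≤ Submodule.span (LaurentPolynomial K) (Set.range v) := by
    rw [← hM0, hspan 0 le_rfl]
    exact Submodule.span_mono (Set.image_subset_range _ _)
  let b := Module.Basis.mk hv htop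
  have hb : ∀ j, b j = v j := fun j => Module.Basis.mk_apply hv htop j
  let c : ι → J → LaurentPolynomial K := fun i j => b.repr (Pi.single i 1) j
  have hrepr : ∀ r j, b.repr r j = ∑ i, r i * c i j := by
    intro r j
    conv_lhs => rw [← (Pi.basisFun (LaurentPolynomial K) ι).sum_repr r]
    simp [c, Finsupp.finsetSum_apply]
  have hvc : ∀ j j', ∑ i, v j i * c i j' = if j = j' then 1 else 0 := by
    intro j j'
    rw [← hrepr, ← hb, b.repr_self, Finsupp.single_apply]
  have hcv : ∀ i i', ∑ j, c i j * v j i' = if i = i' then 1 else 0 := by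
    intro i i'
    have := congrFun (b.sum_repr (Pi.single i 1)) i'
    simp only [Finset.sum_apply, Pi.smul_apply, smul_eq_mul, hb, Pi.single_apply] at this
    rw [this]
    simp only [eq_comm]
  let S := Finset.univ.biUnion fun j => Finset.univ.biUnion fun i => (v j i).coeff.support
  have hS : ∀ j i, (v j i).coeff.support ⊆ S := fun j i m hm =>
    Finset.mem_biUnion.2 ⟨j, Finset.mem_univ _, Finset.mem_biUnion.2 ⟨i, Finset.mem_univ _, hm⟩⟩
  have hconv : ∀ (a : J → ℤ → K) n i, (∑ j, ∑ m ∈ S, a j (n - m) • laurentSeq (v j) m) i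
      = (∑ j, laurentAct K K (v j i) (a j)) n := by
    intro a n i
    simp only [Finset.sum_apply]
    refine Finset.sum_congr rfl fun j _ => ?_
    rw [laurentAct_apply_of_support_subset _ _ _ (hS j i)]
    refine Finset.sum_congr rfl fun m _ => mul_comm _ _
  refine ⟨J, inferInstance, fun j => laurentSeq (v j), k, S, ?_, ?_, ?_, ?_⟩
  · intro j
    have : v j ∈ M (k j) := by
      rw [hspan _ (Nat.zero_le _)]
      exact Submodule.subset_span ⟨j, le_refl (k j), rfl⟩
    exact this
  · intro j m hm
    ext i
    exact Finsupp.notMem_support_iff.1 fun h => hm (hS j i h)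
  · intro h x hx
    refine ⟨fun j => ∑ i, laurentAct K K (c i j) fun n => x n i, ?_, ?_⟩
    · intro j hj
      have hfin : ∀ r ∈ M h, ∑ i, laurentAct K K (c i j) (fun n => laurentSeq r n i) = 0 := by
        intro r hr
        have h0 : b.repr r j = 0 := by
          rw [hspan h (Nat.zero_le _)] at hr
          have hbv : v = b := funext fun j => (hb j).symm
          rw [hbv, b.mem_span_image] at hr
          refine Finsupp.notMem_support_iff.1 fun hj' => ?_
          exact absurd (hr hj') (not_le.2 hj)
        rw [hrepr] at h0
        ext n
        have h1 := congrArg (fun q : LaurentPolynomial K => q.coeff n) h0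
        simp only [laurentSeq, laurentAct_coeff, Finset.sum_apply]
        simpa [Finsupp.finsetSum_apply, mul_comm] using h1
      ext n
      obtain ⟨B, hB⟩ := (Finset.univ.biUnion fun i =>
        (c i j).coeff.support.image Int.natAbs).bddAbove
      obtain ⟨y, hy, hyf, hyx⟩ := hdense h (by omega) x hx (n.natAbs + B)
      obtain ⟨r, rfl⟩ := exists_laurentSeq_eq hyf
      rw [← hfin r hy]
      simp only [Finset.sum_apply, laurentAct_apply]
      refine Finset.sum_congr rfl fun i _ => Finset.sum_congr rfl fun m hm => ?_
      have : m.natAbs ≤ B := hB (Finset.mem_biUnion.2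
        ⟨i, Finset.mem_univ _, Finset.mem_image_of_mem _ hm⟩)
      dsimp only
      rw [hyx]
      rw [abs_le]
      omega
    · intro n
      ext i
      rw [hconv]
      revert n
      rw [← funext_iff]
      calc ∑ j, laurentAct K K (v j i) (∑ i', laurentAct K K (c i' j) fun n => x n i')
          = ∑ i', laurentAct K K (∑ j, c i' j * v j i) (fun n => x n i') := by
            simp only [map_sum, LinearMap.sum_apply]
            rw [Finset.sum_comm]
            simp only [← laurentAct_mul_apply, mul_comm]
        _ = _ := by
            simp only [hcv]
            rw [Finset.sum_eq_single i] <;> simp +contextual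
  · intro a ha
    have ha' : ∀ i, ∑ j, laurentAct K K (v j i) (a j) = 0 := by
      intro i
      ext n
      rw [← hconv, ha]
      rfl
    ext1 j'
    calc a j' = ∑ j, laurentAct K K (∑ i, v j i * c i j') (a j) := by
            simp only [hvc]
            rw [Finset.sum_eq_single j'] <;> simp +contextual
      _ = ∑ i, laurentAct K K (c i j') (∑ j, laurentAct K K (v j i) (a j)) := by
            simp only [map_sum, LinearMap.sum_apply]
            rw [Finset.sum_comm]
            simp only [← laurentAct_mul_apply, mul_comm]
      _ = 0 := by simp [ha']

end LaurentAction

theorem shiftPow_zero {D : Type*} (x : ℤ → D) : shiftPow 0 x = x := by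
  ext i
  simp [shiftPow]

theorem shiftPow_add {D : Type*} (m n : ℤ) (x : ℤ → D) :
    shiftPow m (shiftPow n x) = shiftPow (m + n) x := by
  ext i
  simp only [shiftPow]
  congr 1
  ring

section GroupShift

variable {H : Type*} [AddCommGroup H]

theorem IsGroupShift.shiftPow_mem [TopologicalSpace H] {G : AddSubgroup (ℤ → H)}
    (hG : IsGroupShift G) {x : ℤ → H} (hx : x ∈ G) (n : ℤ) : shiftPow n x ∈ G := by
  have h1 : ∀ x ∈ G, shiftPow 1 x ∈ G := fun x hx =>
    hG.2.subset (Set.mem_image_of_mem shift hx)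
  have h2 : ∀ x ∈ G, shiftPow (-1) x ∈ G := by
    intro x hx
    obtain ⟨y, hy, rfl⟩ := hG.2.superset hx
    rw [shiftPow_add]
    simpa [shiftPow_zero] using hy
  induction n with
  | zero => simpa [shiftPow_zero] using hx
  | succ n ih =>
    rw [add_comm, ← shiftPow_add]
    exact h1 _ ih
  | pred n ih =>
    rw [sub_eq_add_neg, add_comm, ← shiftPow_add]
    exact h2 _ ih

theorem mem_of_forall_window {D : Type*} [TopologicalSpace D] [DiscreteTopology D]
    {V : Set (ℤ → D)} (hV : IsClosed V) {x : ℤ → D}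
    (hx : ∀ n : ℕ, ∃ y ∈ V, ∀ m : ℤ, |m| ≤ n → y m = x m) : x ∈ V := by
  choose y hy hyx using hx
  refine hV.mem_of_tendsto (f := y) (b := Filter.atTop) ?_ (Filter.Eventually.of_forall hy)
  rw [tendsto_pi_nhds]
  intro m
  refine tendsto_const_nhds.congr' ?_
  filter_upwards [Filter.eventually_ge_atTop m.natAbs] with n hn
  rw [hyx]
  rw [abs_le]
  omega

theorem IsOrderControllable.exists_truncation [TopologicalSpace H] {G : AddSubgroup (ℤ → H)}
    (hG : IsGroupShift G) (hoc : IsOrderControllable G) :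
    ∃ n₀ : ℕ, ∀ g ∈ G, ∀ (s : ℤ) (r : ℕ), (∀ i, s < i → i ≤ s + n₀ → r • g i = 0) →
      ∃ g₁ ∈ G, (∀ i ≤ s, g₁ i = g i) ∧ (∀ i, s + n₀ < i → g₁ i = 0) ∧
        ∀ i, s < i → i ≤ s + n₀ → r • g₁ i = 0 := by
  obtain ⟨n₀, -, h⟩ := hoc
  refine ⟨n₀, fun g hg s r hr => ?_⟩
  obtain ⟨g₁, hg₁, h1, h2, h3⟩ := h _ (hG.shiftPow_mem hg s)
  refine ⟨_, hG.shiftPow_mem hg₁ (-s), fun i hi => ?_, fun i hi => ?_, fun i hi hi' => ?_⟩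
  · simp only [shiftPow]
    rw [h1 _ (by omega), shiftPow]
    congr 1
    ring
  · exact h2 _ (by omega)
  · have h4 : addOrderOf (fun j : Fin n₀ => g₁ ((j : ℤ) + 1)) ∣ r := by
      refine h3.trans (addOrderOf_dvd_of_nsmul_eq_zero ?_)
      ext j
      exact hr _ (by omega) (by omega)
    have h5 := congrFun (addOrderOf_dvd_iff_nsmul_eq_zero.1 h4) ⟨(i - s - 1).toNat, by omega⟩
    have h6 : (((i - s - 1).toNat : ℕ) : ℤ) + 1 = i + -s := by omega
    simp only [Pi.smul_apply, h6] at h5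
    exact h5

theorem IsOrderControllable.exists_finite [TopologicalSpace H] {G : AddSubgroup (ℤ → H)}
    (hG : IsGroupShift G) (hoc : IsOrderControllable G) {g : ℤ → H} (hg : g ∈ G) (r n : ℕ)
    (hr : ∀ i : ℤ, (n : ℤ) < |i| → r • g i = 0) :
    ∃ g' ∈ G, (support g').Finite ∧ (∀ i : ℤ, |i| ≤ n → g' i = g i) ∧
      ∀ i : ℤ, (n : ℤ) < |i| → r • g' i = 0 := by
  obtain ⟨n₀, h⟩ := hoc.exists_truncation hG
  obtain ⟨g₁, hg₁, h1, h2, h3⟩ := h g hg n r fun i hi _ => hr i (hi.trans_le (le_abs_self i))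
  have h4 : ∀ i < -(n : ℤ), r • g₁ i = 0 := fun i hi => by
    rw [h1 i (by omega)]
    exact hr i (lt_abs.2 (by omega))
  obtain ⟨g₂, hg₂, k1, k2, k3⟩ := h g₁ hg₁ (-n - 1 - n₀) r fun i _ hi => h4 i (by omega)
  refine ⟨g₁ - g₂, G.sub_mem hg₁ hg₂, ?_, fun i hi => ?_, fun i hi => ?_⟩
  · refine (Set.finite_Icc (-n - n₀ : ℤ) (n + n₀)).subset fun i hi => ?_
    by_contra hne
    refine hi ?_
    rw [Set.mem_Icc, not_and_or] at hne
    rw [Pi.sub_apply]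
    rcases hne with hne | hne
    · rw [k1 i (by omega), sub_self]
    · rw [h2 i (by omega), k2 i (by omega), sub_self]
  · rw [abs_le] at hi
    rw [Pi.sub_apply, k2 i (by omega), h1 i (by omega), sub_zero]
  · rw [Pi.sub_apply, smul_sub]
    rcases lt_abs.1 hi with hi | hi
    · rw [k2 i (by omega), smul_zero, sub_zero]
      by_cases hi' : i ≤ n + n₀
      · exact h3 i hi hi'
      · rw [h2 i (by omega), smul_zero]
    · rw [h4 i (by omega), zero_sub, neg_eq_zero]
      by_cases hi' : i ≤ -n - 1 - n₀
      · rw [k1 i hi', h4 i (by omega)]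
      · exact k3 i (by omega) (by omega)

/-- The subgroup `p ^ h • G[p ^ (h + 1)]` of the socle of `G`. -/
def socleLayer (p : ℕ) (G : AddSubgroup (ℤ → H)) (h : ℕ) : AddSubgroup (ℤ → H) :=
  (G ⊓ (nsmulAddMonoidHom (p ^ (h + 1))).ker).map (nsmulAddMonoidHom (p ^ h))

theorem mem_socleLayer {p : ℕ} {G : AddSubgroup (ℤ → H)} {h : ℕ} {x : ℤ → H} :
    x ∈ socleLayer p G h ↔ ∃ g ∈ G, p ^ (h + 1) • g = 0 ∧ p ^ h • g = x := by
  simp [socleLayer, AddSubgroup.mem_map, AddMonoidHom.mem_ker, and_assoc]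

theorem isClosed_socleLayer [Finite H] [TopologicalSpace H] [DiscreteTopology H] (p : ℕ)
    {G : AddSubgroup (ℤ → H)} (hG : IsClosed (G : Set (ℤ → H))) (h : ℕ) :
    IsClosed (socleLayer p G h : Set (ℤ → H)) := by
  have : (socleLayer p G h : Set (ℤ → H)) =
      (fun x => p ^ h • x) '' (G ∩ (fun x => p ^ (h + 1) • x) ⁻¹' {0}) := by
    ext x
    simp [mem_socleLayer, and_assoc]
  rw [this]
  refine IsCompact.isClosed (IsCompact.image ?_ (continuous_const_smul _))
  exact (hG.inter (isClosed_singleton.preimage (continuous_const_smul _))).isCompact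

theorem exists_linearEquiv_fin_zmod (p : ℕ) [Fact p.Prime] (A : Type*) [AddCommGroup A]
    [Finite A] [Module (ZMod p) A] : ∃ d : ℕ, Nonempty ((Fin d → ZMod p) ≃ₗ[ZMod p] A) := by
  have : Module.Finite (ZMod p) A := Module.Finite.of_finite
  exact ⟨_, ⟨(Module.finBasis (ZMod p) A).equivFun.symm⟩⟩

theorem exists_addEquiv_fin_zmod {V : Type*} [AddCommGroup V] [Finite V] (p : ℕ) [Fact p.Prime]
    (h : ∀ x : V, p • x = 0) : ∃ d : ℕ, Nonempty ((Fin d → ZMod p) ≃+ V) := by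
  let _ : Module (ZMod p) V := AddCommGroup.zmodModule h
  obtain ⟨d, ⟨e⟩⟩ := exists_linearEquiv_fin_zmod p V
  exact ⟨d, ⟨e.toAddEquiv⟩⟩

theorem exists_torsion_coordinates [Finite H] (p : ℕ) [Fact p.Prime] :
    ∃ (d : ℕ) (φ : (Fin d → ZMod p) →+ H), Injective φ ∧ ∀ x, p • x = 0 ↔ x ∈ φ.range := by
  let A := (nsmulAddMonoidHom (α := H) p).ker
  obtain ⟨d, ⟨ψ⟩⟩ := exists_addEquiv_fin_zmod (V := A) p fun x => Subtype.ext x.2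
  refine ⟨d, A.subtype.comp ψ.toAddMonoidHom,
    Subtype.coe_injective.comp ψ.injective, fun x => ⟨fun hx => ?_, ?_⟩⟩
  · exact ⟨ψ.symm ⟨x, hx⟩, by simp⟩
  · rintro ⟨y, rfl⟩
    exact (ψ y).2

/-- The socle layers in coordinates, indexed so that level `h` consists of the elements divisible
by `p ^ (h - 1)`; level `0` is everything. -/
def coordLayer (p : ℕ) {d : ℕ} (φ : (Fin d → ZMod p) →+ H) (G : AddSubgroup (ℤ → H)) :
    ℕ → Submodule (ZMod p) (ℤ → Fin d → ZMod p)
  | 0 => ⊤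
  | h + 1 => AddSubgroup.toZModSubmodule p ((socleLayer p G h).comap (φ.compLeft ℤ))

theorem mem_coordLayer_succ {p d : ℕ} {φ : (Fin d → ZMod p) →+ H} {G : AddSubgroup (ℤ → H)}
    {h : ℕ} {x : ℤ → Fin d → ZMod p} : x ∈ coordLayer p φ G (h + 1) ↔
      ∃ g ∈ G, p ^ (h + 1) • g = 0 ∧ p ^ h • g = fun n => φ (x n) :=
  mem_socleLayer

theorem exists_lift_of_mem_coordLayer [TopologicalSpace H] {G : AddSubgroup (ℤ → H)}
    (hG : IsGroupShift G) (hoc : IsOrderControllable G) {p d : ℕ} {φ : (Fin d → ZMod p) →+ H}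
    {h : ℕ} {x : ℤ → Fin d → ZMod p} (hx : x ∈ coordLayer p φ G (h + 1))
    (hfin : (support x).Finite) :
    ∃ f ∈ G, (support f).Finite ∧ p ^ h • f = fun n => φ (x n) := by
  obtain ⟨g, hg, -, hgx⟩ := mem_coordLayer_succ.1 hx
  obtain ⟨B, hB⟩ := (hfin.image Int.natAbs).bddAbove
  have hzero : ∀ i : ℤ, (B : ℤ) < |i| → x i = 0 := by
    intro i hi
    by_contra hne
    have : i.natAbs ≤ B := hB (Set.mem_image_of_mem _ hne)
    rw [Int.abs_eq_natAbs] at hi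
    omega
  have hgx' : ∀ i, p ^ h • g i = φ (x i) := congrFun hgx
  obtain ⟨f, hf, hfs, h1, h2⟩ := hoc.exists_finite hG hg (p ^ h) B fun i hi => by
    rw [hgx', hzero i hi, map_zero]
  refine ⟨f, hf, hfs, ?_⟩
  ext i
  by_cases hi : |i| ≤ B
  · rw [Pi.smul_apply, h1 i hi, hgx']
  · rw [Pi.smul_apply, h2 i (not_le.1 hi), hzero i (not_le.1 hi), map_zero]

theorem sum_fin_eq_sum_of_pos {J M : Type*} [Fintype J] [AddCommMonoid M] (k : J → ℕ) {m : ℕ}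
    (ε : {j // 0 < k j} ≃ Fin m) (t : J → M) (ht : ∀ j, k j = 0 → t j = 0) :
    ∑ i, t (ε.symm i) = ∑ j, t j := by
  classical
  rw [ε.symm.sum_comp (fun j : {j // 0 < k j} => t j)]
  rw [← Finset.sum_filter_of_ne (p := fun j => 0 < k j) (s := Finset.univ)]
  · exact (Finset.sum_subtype _ (by simp) _).symm
  · intro j _ hj
    exact Nat.pos_of_ne_zero fun h => hj (ht j h)

theorem exists_generators [Finite H] [TopologicalSpace H] [DiscreteTopology H]
    {G : AddSubgroup (ℤ → H)} (hG : IsGroupShift G) (hoc : IsOrderControllable G)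
    {p : ℕ} (hp : p.Prime) {e : ℕ} (he : ∀ x : H, p ^ e • x = 0) :
    ∃ (m : ℕ) (h : Fin m → ℕ) (f : Fin m → ℤ → H) (S : Finset ℤ),
      (∀ j, 0 < h j) ∧ (∀ j, f j ∈ G) ∧ (∀ j, ∀ n ∉ S, f j n = 0) ∧
      (∀ j, p ^ h j • f j = 0) ∧
      (∀ l, ∀ g ∈ G, p ^ (l + 1) • g = 0 → ∃ a : Fin m → ℤ → ℤ, (∀ j, h j < l + 1 → a j = 0) ∧
        ∀ n, ∑ j, ∑ i ∈ S, a j (n - i) • p ^ (h j - 1) • f j i = p ^ l • g n) ∧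
      ∀ a : Fin m → ℤ → ℤ,
        (∀ n, ∑ j, ∑ i ∈ S, a j (n - i) • p ^ (h j - 1) • f j i = 0) → ∀ j n, (p : ℤ) ∣ a j n := by
  have : Fact p.Prime := ⟨hp⟩
  obtain ⟨d, φ, hφ, hφr⟩ := exists_torsion_coordinates (H := H) p
  have hcoord : ∀ y : ℤ → H, p • y = 0 → ∃ x : ℤ → Fin d → ZMod p, (fun n => φ (x n)) = y := by
    intro y hy
    choose x hx using fun n => (hφr (y n)).1 (congrFun hy n)
    exact ⟨x, funext hx⟩
  have hlast : coordLayer p φ G (e + 1) = ⊥ := by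
    rw [eq_bot_iff]
    intro x hx
    obtain ⟨g, -, -, hgx⟩ := mem_coordLayer_succ.1 hx
    rw [Submodule.mem_bot]
    ext1 n
    refine hφ ?_
    rw [← congrFun hgx n]
    simp [he]
  have hanti : Antitone (coordLayer p φ G) := by
    refine antitone_nat_of_succ_le fun h => ?_
    cases h with
    | zero => exact le_top
    | succ h =>
      intro x hx
      obtain ⟨g, hg, hg0, hgx⟩ := mem_coordLayer_succ.1 hx
      refine mem_coordLayer_succ.2 ⟨p • g, G.nsmul_mem hg p, ?_, ?_⟩
      · rwa [smul_smul, ← pow_succ]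
      · rwa [smul_smul, ← pow_succ]
  have hshift : ∀ h, ∀ x ∈ coordLayer p φ G h, ∀ n : ℤ, shiftPow n x ∈ coordLayer p φ G h := by
    intro h x hx n
    cases h with
    | zero => trivial
    | succ h =>
      obtain ⟨g, hg, hg0, hgx⟩ := mem_coordLayer_succ.1 hx
      refine mem_coordLayer_succ.2 ⟨_, hG.shiftPow_mem hg n, ?_, ?_⟩
      · ext i
        exact congrFun hg0 (i + n)
      · ext i
        exact congrFun hgx (i + n)
  have hclosed : ∀ h x, (∀ n : ℕ, ∃ y ∈ coordLayer p φ G h, ∀ m : ℤ, |m| ≤ n → y m = x m) →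
      x ∈ coordLayer p φ G h := by
    intro h x hx
    cases h with
    | zero => trivial
    | succ h =>
      refine mem_of_forall_window (isClosed_socleLayer p hG.1 h) fun n => ?_
      obtain ⟨y, hy, hyx⟩ := hx n
      exact ⟨fun m => φ (y m), hy, fun m hm => congrArg φ (hyx m hm)⟩
  have hdense : ∀ h, 0 < h → ∀ x ∈ coordLayer p φ G h, ∀ n : ℕ, ∃ y ∈ coordLayer p φ G h,
      (support y).Finite ∧ ∀ m : ℤ, |m| ≤ n → y m = x m := by
    intro h hh x hx n
    obtain ⟨h, rfl⟩ := Nat.exists_eq_succ_of_ne_zero hh.ne'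
    obtain ⟨g, hg, hg0, hgx⟩ := mem_coordLayer_succ.1 hx
    obtain ⟨g', hg', hfin, h1, h2⟩ := hoc.exists_finite hG hg (p ^ (h + 1)) n
      fun i _ => congrFun hg0 i
    have hg0' : p ^ (h + 1) • g' = 0 := by
      ext i
      by_cases hi : |i| ≤ n
      · rw [Pi.smul_apply, h1 i hi]
        exact congrFun hg0 i
      · exact h2 i (not_le.1 hi)
    obtain ⟨y, hy⟩ := hcoord (p ^ h • g') (by rwa [smul_smul, ← pow_succ'])
    refine ⟨y, mem_coordLayer_succ.2 ⟨g', hg', hg0', hy.symm⟩, hfin.subset fun i hi h0 => hi ?_,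
      fun m hm => hφ ?_⟩
    · refine hφ ?_
      rw [congrFun hy i, Pi.smul_apply, h0, smul_zero, map_zero]
    · rw [congrFun hy m, Pi.smul_apply, h1 m hm]
      exact congrFun hgx m
  obtain ⟨J, _, v, k, S, hvk, hvS, hspan, hind⟩ :=
    exists_adapted_generators (coordLayer p φ G) rfl hanti hlast hshift hclosed hdense
  have hvfin : ∀ j, (support (v j)).Finite := fun j =>
    S.finite_toSet.subset fun n hn => by
      by_contra h
      exact hn (hvS j n h)
  have ε := Fintype.equivFin {j // 0 < k j}
  let ι : Fin (Fintype.card {j // 0 < k j}) → J := fun i => ε.symm i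
  have hι : ∀ i, 0 < k (ι i) := fun i => (ε.symm i).2
  have hlift : ∀ i, ∃ f ∈ G, (support f).Finite ∧
      p ^ (k (ι i) - 1) • f = fun n => φ (v (ι i) n) := by
    intro i
    refine exists_lift_of_mem_coordLayer hG hoc ?_ (hvfin _)
    rw [Nat.sub_add_cancel (hι i)]
    exact hvk _
  choose f hfG hffin hf using hlift
  let S' : Finset ℤ := S ∪ Finset.univ.biUnion fun i => (hffin i).toFinset
  have hconv : ∀ (a : J → ℤ → ZMod p) (b : Fin (Fintype.card {j // 0 < k j}) → ℤ → ℤ),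
      (∀ j, k j = 0 → a j = 0) → (∀ i n, a (ι i) n = b i n) → ∀ n,
      ∑ i, ∑ m ∈ S', b i (n - m) • p ^ (k (ι i) - 1) • f i m =
        φ (∑ j, ∑ m ∈ S, a j (n - m) • v j m) := by
    intro a b ha hab n
    rw [← sum_fin_eq_sum_of_pos k ε _ fun j hj => by simp [ha j hj], map_sum]
    refine Finset.sum_congr rfl fun i _ => ?_
    rw [map_sum]
    refine (Finset.sum_subset Finset.subset_union_left fun m _ hm => ?_).symm.trans ?_
    · rw [← Pi.smul_apply (p ^ (k (ι i) - 1)), hf]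
      simp [hvS _ m hm]
    · refine Finset.sum_congr rfl fun m _ => ?_
      change _ = φ (a (ι i) (n - m) • v (ι i) m)
      rw [hab, ← Pi.smul_apply (p ^ (k (ι i) - 1)), hf, ← map_zsmul]
      congr 1
      exact (Int.cast_smul_eq_zsmul (ZMod p) _ _).symm
  refine ⟨_, fun i => k (ι i), f, S', hι, hfG, ?_, ?_, ?_, ?_⟩
  · intro i n hn
    by_contra h
    exact hn (Finset.mem_union_right _ (Finset.mem_biUnion.2
      ⟨i, Finset.mem_univ _, (hffin i).mem_toFinset.2 h⟩))
  · intro i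
    have hpow : p ^ k (ι i) = p * p ^ (k (ι i) - 1) := by
      rw [← pow_succ', Nat.sub_add_cancel (hι i)]
    change p ^ k (ι i) • f i = 0
    rw [hpow, mul_smul, hf]
    ext n
    exact (hφr _).2 ⟨_, rfl⟩
  · intro l g hg hg0
    obtain ⟨x, hx⟩ := hcoord (p ^ l • g) (by rwa [smul_smul, ← pow_succ'])
    obtain ⟨a, ha, hax⟩ := hspan (l + 1) x (mem_coordLayer_succ.2 ⟨g, hg, hg0, hx.symm⟩)
    refine ⟨fun i n => (a (ι i) n).val, fun i hi => ?_, fun n => ?_⟩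
    · ext n
      simp [ha _ hi]
    · refine (hconv a (fun i n => (a (ι i) n).val) (fun j hj => ha j (by omega)) (by simp)
        n).trans ?_
      rw [hax]
      exact congrFun hx n
  · intro b hb i n
    let a : J → ℤ → ZMod p := fun j n => if h : 0 < k j then (b (ε ⟨j, h⟩) n : ZMod p) else 0
    have hab : ∀ i n, a (ι i) n = b i n := by
      intro i n
      simp only [a, dif_pos (hι i)]
      congr 2
      exact ε.apply_symm_apply i
    have ha := hind a fun n => hφ (by
      refine (hconv a b (fun j hj => by ext; simp [a, hj]) hab n).symm.trans ?_
      rw [hb n]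
      exact (map_zero φ).symm)
    rw [← ZMod.intCast_zmod_eq_zero_iff_dvd, ← hab, ha]
    rfl

end GroupShift

section Convolution

variable {J H : Type*} [Fintype J] [AddCommGroup H] {K : J → Type*} [∀ j, AddCommGroup (K j)]

/-- The sliding block homomorphism with taps `F j i`, for `i` in the finite window `S`. -/
def blockHom (S : Finset ℤ) (F : ∀ j, ℤ → K j →+ H) : (ℤ → ∀ j, K j) →+ (ℤ → H) where
  toFun u n := ∑ j, ∑ i ∈ S, F j i (u (n - i) j)
  map_zero' := by
    ext n
    simp
  map_add' u v := by
    ext n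
    simp [Finset.sum_add_distrib]

theorem blockHom_apply (S : Finset ℤ) (F : ∀ j, ℤ → K j →+ H) (u : ℤ → ∀ j, K j) (n : ℤ) :
    blockHom S F u n = ∑ j, ∑ i ∈ S, F j i (u (n - i) j) := rfl

theorem blockHom_shiftPow (S : Finset ℤ) (F : ∀ j, ℤ → K j →+ H) (u : ℤ → ∀ j, K j) (n : ℤ) :
    blockHom S F (shiftPow n u) = shiftPow n (blockHom S F u) := by
  ext i
  simp only [blockHom_apply, shiftPow, sub_add_eq_add_sub]

theorem continuous_blockHom [TopologicalSpace H] [ContinuousAdd H] [∀ j, TopologicalSpace (K j)]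
    [∀ j, DiscreteTopology (K j)] (S : Finset ℤ) (F : ∀ j, ℤ → K j →+ H) :
    Continuous (blockHom S F) := by
  refine continuous_pi fun n => continuous_finsetSum _ fun j _ => continuous_finsetSum _ fun i _ =>
    continuous_of_discreteTopology.comp ?_
  exact (continuous_apply j).comp (continuous_apply (n - i))

theorem blockHom_mem [TopologicalSpace H] [DiscreteTopology H] {G : AddSubgroup (ℤ → H)}
    (hG : IsGroupShift G) {S : Finset ℤ} {F : ∀ j, ℤ → K j →+ H}
    (hF : ∀ j x, ∃ g ∈ G, (∀ i ∈ S, g i = F j i x) ∧ ∀ i ∉ S, g i = 0) (u : ℤ → ∀ j, K j) :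
    blockHom S F u ∈ G := by
  choose g hgG hgS hg0 using hF
  refine mem_of_forall_window hG.1 fun N => ?_
  let T : Finset ℤ := (Finset.Icc (-N : ℤ) N ×ˢ S).image fun x => x.1 - x.2
  refine ⟨∑ j, ∑ t ∈ T, shiftPow (-t) (g j (u t j)),
    G.sum_mem fun j _ => G.sum_mem fun t _ => hG.shiftPow_mem (hgG _ _) _, fun n hn => ?_⟩
  rw [blockHom_apply, Finset.sum_apply]
  refine Finset.sum_congr rfl fun j _ => ?_
  rw [Finset.sum_apply]
  classical
  have h1 : S.image (fun i => n - i) ⊆ T := by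
    intro t ht
    obtain ⟨i, hi, rfl⟩ := Finset.mem_image.1 ht
    exact Finset.mem_image.2 ⟨(n, i), Finset.mem_product.2
      ⟨Finset.mem_Icc.2 (abs_le.1 hn), hi⟩, rfl⟩
  rw [← Finset.sum_subset h1, Finset.sum_image]
  · refine Finset.sum_congr rfl fun i hi => ?_
    rw [← hgS j _ i hi, shiftPow]
    congr 1
    ring
  · intro a _ b _ hab
    exact sub_right_injective hab
  · intro t _ ht
    refine hg0 _ _ _ fun hmem => ht (Finset.mem_image.2 ⟨_, hmem, ?_⟩)
    ring

end Convolution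

theorem finite_support_iff_tendsto {D : Type*} [Zero D] [TopologicalSpace D] [DiscreteTopology D]
    {x : ℤ → D} : (support x).Finite ↔
      Filter.Tendsto (fun n => shiftPow n x) Filter.cofinite (𝓝 (0 : ℤ → D)) := by
  rw [tendsto_pi_nhds]
  simp only [Pi.zero_apply, nhds_discrete, Filter.tendsto_pure, Filter.eventually_cofinite]
  constructor
  · intro h i
    exact (h.preimage (add_right_injective i).injOn)
  · intro h
    simpa [shiftPow, support] using h 0

theorem isNoncatEncoder_of_bijective {H K : Type*} [AddCommGroup H] [TopologicalSpace H]
    [DiscreteTopology H] [AddCommGroup K] [Finite K] [TopologicalSpace K] [DiscreteTopology K]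
    {G : AddSubgroup (ℤ → H)} (Ψ : (ℤ → K) →+ (ℤ → H)) (hinj : Injective Ψ)
    (hran : Ψ.range = G) (hcont : Continuous Ψ)
    (hshift : ∀ n u, Ψ (shiftPow n u) = shiftPow n (Ψ u)) : IsNoncatEncoder G K := by
  subst hran
  let Φ : (ℤ → K) ≃+ Ψ.range := AddMonoidHom.ofInjective hinj
  have hΦ : Continuous Φ := hcont.subtype_mk _
  have hemb : IsEmbedding Ψ := (hcont.isClosedEmbedding hinj).isEmbedding
  refine ⟨Φ, hΦ, (hΦ.homeoOfEquivCompactToT2 (f := Φ.toEquiv)).continuous_symm, hshift 1, ?_⟩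
  ext x
  constructor
  · rintro ⟨u, hu, rfl⟩
    refine ⟨(Φ u).2, finite_support_iff_tendsto.2 ?_⟩
    have := (hcont.tendsto 0).comp (finite_support_iff_tendsto.1 hu)
    rw [map_zero] at this
    exact this.congr fun n => hshift n u
  · rintro ⟨⟨u, rfl⟩, hu⟩
    refine ⟨u, finite_support_iff_tendsto.2 (hemb.tendsto_nhds_iff.2 ?_), rfl⟩
    rw [map_zero]
    exact (finite_support_iff_tendsto.1 hu).congr fun n => (hshift n u).symm

theorem exists_eq_pow_mul_of_nsmul_eq_zero {p k : ℕ} (hp : p.Prime) (hk : 0 < k)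
    {x : ZMod (p ^ k)} (hx : p • x = 0) : ∃ b : ℤ, x = ((b * p ^ (k - 1) : ℤ) : ZMod (p ^ k)) := by
  have hpow : p ^ k = p * p ^ (k - 1) := by rw [← pow_succ', Nat.sub_add_cancel hk]
  have : NeZero (p ^ k) := ⟨(pow_pos hp.pos k).ne'⟩
  have h1 : ((p * x.val : ℕ) : ZMod (p ^ k)) = 0 := by
    rw [Nat.cast_mul, ZMod.natCast_zmod_val, ← nsmul_eq_mul, hx]
  rw [ZMod.natCast_eq_zero_iff] at h1
  obtain ⟨b, hb⟩ := (mul_dvd_mul_iff_left hp.ne_zero).1 (hpow ▸ h1 : p * p ^ (k - 1) ∣ p * x.val)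
  refine ⟨b, ?_⟩
  rw [← ZMod.natCast_zmod_val x, hb]
  push_cast
  ring

/-- Let `p` be a prime, `H` a finite abelian `p`-group and `G` an order
controllable group shift over `H`.  Then there are `m ∈ ℕ` and positive integers
`h₁,…,h_m` together with a noncatastrophic isomorphic encoder
`Φ : (∏_j ℤ/p^{h_j}ℤ)^ℤ → G`; in particular `G` is algebraically and topologically
conjugate to a full group shift over a finite abelian `p`-group. -/
theorem order_controllable_p_group_encoder
    (p : ℕ) (hp : p.Prime)
    {H : Type} [AddCommGroup H] [Fintype H] [TopologicalSpace H] [DiscreteTopology H]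
    (hH : ∃ n : ℕ, Fintype.card H = p ^ n)
    (G : AddSubgroup (ℤ → H)) (hG : IsGroupShift G) (hoc : IsOrderControllable G) :
    ∃ (m : ℕ) (h : Fin m → ℕ), (∀ j, 0 < h j) ∧
      IsNoncatEncoder G (∀ j : Fin m, ZMod (p ^ (h j))) := by
  obtain ⟨e, he⟩ := hH
  have he' : ∀ x : H, p ^ e • x = 0 := fun x => he ▸ card_nsmul_eq_zero
  obtain ⟨m, h, f, S, hpos, hfG, hfS, hftor, hspan, hind⟩ := exists_generators hG hoc hp he'
  refine ⟨m, h, hpos, ?_⟩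
  have hne : ∀ j, NeZero (p ^ h j) := fun j => ⟨(pow_pos hp.pos _).ne'⟩
  let F : ∀ j, ℤ → ZMod (p ^ h j) →+ H := fun j i =>
    ZMod.lift (p ^ h j) ⟨zmultiplesHom H (f j i), by
      rw [zmultiplesHom_apply, natCast_zsmul]
      exact congrFun (hftor j) i⟩
  have hF : ∀ j i (a : ℤ), F j i a = a • f j i := fun j i a => by simp [F]
  have hF' : ∀ j i x, F j i x = (x.val : ℤ) • f j i := fun j i x => by
    rw [← hF, Int.cast_natCast, ZMod.natCast_zmod_val]
  have hmem : ∀ u, blockHom S F u ∈ G := by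
    refine blockHom_mem hG fun j x => ⟨(x.val : ℤ) • f j, G.zsmul_mem (hfG j) _,
      fun i _ => (hF' j i x).symm, fun i hi => ?_⟩
    rw [Pi.smul_apply, hfS j i hi, smul_zero]
  have hsocle : ∀ u, blockHom S F u = 0 → p • u = 0 → u = 0 := by
    intro u hu hpu
    choose b hb using fun j n => exists_eq_pow_mul_of_nsmul_eq_zero hp (hpos j)
      (congrFun (congrFun hpu n) j)
    have hdvd := hind b fun n => by
      refine Eq.trans ?_ (congrFun hu n)
      rw [blockHom_apply]
      refine Finset.sum_congr rfl fun j _ => Finset.sum_congr rfl fun i _ => ?_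
      rw [hb, hF, mul_smul]
      norm_cast
    ext n j
    obtain ⟨c, hc⟩ := hdvd j n
    have hpow : (p : ℤ) * p ^ (h j - 1) = (p ^ h j : ℕ) := by
      rw [← pow_succ', Nat.sub_add_cancel (hpos j), Nat.cast_pow]
    rw [hb, hc, mul_right_comm, hpow, Int.cast_mul, Int.cast_natCast, ZMod.natCast_self, zero_mul]
    rfl
  have htor : ∀ k u, p ^ k • u = 0 → blockHom S F u = 0 → u = 0 := by
    intro k
    induction k with
    | zero => exact fun u hu _ => by simpa using hu
    | succ k ih =>
      intro u hu hu0
      refine hsocle u hu0 (ih _ ?_ ?_)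
      · rwa [smul_smul, ← pow_succ]
      · rw [map_nsmul, hu0, smul_zero]
  have hsurj : ∀ k, ∀ g ∈ G, p ^ k • g = 0 → ∃ u, blockHom S F u = g := by
    intro k
    induction k with
    | zero => exact fun g _ hg => ⟨0, by simpa using hg.symm⟩
    | succ l ih =>
      intro g hg hg0
      obtain ⟨a, ha, hag⟩ := hspan l g hg hg0
      let u : ℤ → ∀ j, ZMod (p ^ h j) := fun n j => ((a j n * p ^ (h j - 1 - l) : ℤ) : ZMod _)
      have hu : p ^ l • blockHom S F u = p ^ l • g := by
        ext n
        rw [Pi.smul_apply, Pi.smul_apply, ← hag n, blockHom_apply, Finset.smul_sum]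
        refine Finset.sum_congr rfl fun j _ => ?_
        rw [Finset.smul_sum]
        refine Finset.sum_congr rfl fun i _ => ?_
        rw [hF]
        by_cases hj : h j < l + 1
        · simp [ha j hj]
        · have hpow : p ^ (h j - 1) = p ^ l * p ^ (h j - 1 - l) := by
            rw [← pow_add]
            congr 1
            omega
          rw [mul_smul, smul_comm, hpow, mul_smul]
          norm_cast
      obtain ⟨v, hv⟩ := ih (g - blockHom S F u) (G.sub_mem hg (hmem u)) (by
        rw [smul_sub, hu, sub_self])
      exact ⟨v + u, by rw [map_add, hv, sub_add_cancel]⟩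
  refine isNoncatEncoder_of_bijective (blockHom S F) ?_ ?_ (continuous_blockHom S F)
    fun n u => blockHom_shiftPow S F u n
  · refine (injective_iff_map_eq_zero _).2 fun u hu => htor (∑ j, h j) u ?_ hu
    ext n j
    obtain ⟨c, hc⟩ := pow_dvd_pow p (Finset.single_le_sum (f := h) (fun _ _ => Nat.zero_le _)
      (Finset.mem_univ j))
    change p ^ (∑ j, h j) • u n j = 0
    rw [hc, mul_comm, mul_smul, nsmul_eq_mul (p ^ h j), ZMod.natCast_self, zero_mul, smul_zero]
  · ext g
    refine ⟨?_, fun hg => hsurj e g hg ?_⟩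
    · rintro ⟨u, rfl⟩
      exact hmem u
    · ext n
      exact he' _
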